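/- Fix ρ > 0 and assume d(n) → ∞ and (n − d)/d → ρ. Define g_ρ(r) = (ρ+1)ln(ρ+1) − ρ·ln ρ − r²/2 + ρ·ln Φ(r) and let M = max_{r∈ℝ} g_ρ(r). Then M > 0 and (1/d)·ln F(n,d,−1,1) → M as n → ∞; that is, F(n,d,−1,1) = e^{dM + o(d)}. -/

import Mathlib

open Filter

noncomputable def c1 (d : ℕ) : ℝ :=
  Real.Gamma ((d : ℝ) / 2) / (Real.sqrt Real.pi * Real.Gamma (((d : ℝ) - 1) / 2))

noncomputable def c2 (d : ℕ) : ℝ :=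
  Real.Gamma (((d : ℝ) ^ 2 - 2 * (d : ℝ) + 2) / 2) /
    (Real.sqrt Real.pi * Real.Gamma (((d : ℝ) ^ 2 - 2 * (d : ℝ) + 1) / 2))

/-- `II n d a b` is the integral `I(n,d,a,b)` from the paper. -/
noncomputable def II (n d : ℕ) (a b : ℝ) : ℝ :=
  ∫ h in a..b, (1 - h ^ 2) ^ (((d : ℝ) ^ 2 - 2 * (d : ℝ) - 1) / 2) *
    (c1 d * ∫ s in (-1 : ℝ)..h, (1 - s ^ 2) ^ (((d : ℝ) - 3) / 2)) ^ (n - d)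

/-- `FF n d a b` is the expected number of facets with height in `[a,b]`. -/
noncomputable def FF (n d : ℕ) (a b : ℝ) : ℝ :=
  (n.choose d : ℝ) * 2 * c2 d * II n d a b

/-- The standard normal CDF. -/
noncomputable def stdPhi (r : ℝ) : ℝ :=
  (Real.sqrt (2 * Real.pi))⁻¹ * ∫ s in Set.Iic r, Real.exp (-s ^ 2 / 2)

/-- `g_ρ(r) = (ρ+1)ln(ρ+1) - ρ ln ρ - r²/2 + ρ ln Φ(r)`. -/
noncomputable def grho (ρ r : ℝ) : ℝ :=
  (ρ + 1) * Real.log (ρ + 1) - ρ * Real.log ρ - r ^ 2 / 2 + ρ * Real.log (stdPhi r)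

open Topology MeasureTheory

/-! ### Gamma ratios and the normalising constants -/

theorem gamma_ratio_sq_le {x : ℝ} (hx : 0 < x) :
    (Real.Gamma (x + 1 / 2) / Real.Gamma x) ^ 2 ≤ x := by
  have h := Real.Gamma_mul_add_mul_le_rpow_Gamma_mul_rpow_Gamma hx (by linarith : 0 < x + 1)
    (by norm_num : (0 : ℝ) < 1 / 2) (by norm_num : (0 : ℝ) < 1 / 2) (by norm_num)
  have hG := Real.Gamma_pos_of_pos hx
  have hG' := Real.Gamma_pos_of_pos (by linarith : 0 < x + 1 / 2)
  rw [show 1 / 2 * x + 1 / 2 * (x + 1) = x + 1 / 2 by ring, Real.Gamma_add_one hx.ne',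
    ← Real.sqrt_eq_rpow, ← Real.sqrt_eq_rpow, Real.sqrt_mul hx.le, mul_left_comm,
    Real.mul_self_sqrt hG.le] at h
  have h2 : Real.Gamma (x + 1 / 2) / Real.Gamma x ≤ √x := by
    rw [div_le_iff₀ hG]; exact h
  calc _ ≤ (√x) ^ 2 := by gcongr
    _ = x := Real.sq_sqrt hx.le

theorem le_gamma_ratio_sq {x : ℝ} (hx : 1 / 2 < x) :
    x - 1 / 2 ≤ (Real.Gamma (x + 1 / 2) / Real.Gamma x) ^ 2 := by
  have hy : 0 < x - 1 / 2 := by linarith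
  have h := gamma_ratio_sq_le hy
  have hG := Real.Gamma_pos_of_pos (by linarith : 0 < x)
  have hG' := Real.Gamma_pos_of_pos hy
  have h1 : Real.Gamma (x + 1 / 2) = (x - 1 / 2) * Real.Gamma (x - 1 / 2) := by
    rw [← Real.Gamma_add_one hy.ne']; congr 1; ring
  rw [sub_add_cancel] at h
  rw [h1]
  rw [div_pow, div_le_iff₀ (by positivity)] at h
  rw [div_pow, le_div_iff₀ (by positivity)]
  nlinarith

theorem c1_pos {d : ℕ} (hd : 2 ≤ d) : 0 < c1 d := by
  have : (2 : ℝ) ≤ d := by exact_mod_cast hd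
  have h1 := Real.Gamma_pos_of_pos (by linarith : 0 < (d : ℝ) / 2)
  have h2 := Real.Gamma_pos_of_pos (by linarith : 0 < ((d : ℝ) - 1) / 2)
  unfold c1
  positivity

theorem c1_sq_bounds {d : ℕ} (hd : 3 ≤ d) :
    ((d : ℝ) - 2) / (2 * Real.pi) ≤ c1 d ^ 2 ∧ c1 d ^ 2 ≤ ((d : ℝ) - 1) / (2 * Real.pi) := by
  have h3 : (3 : ℝ) ≤ d := by exact_mod_cast hd
  have hu := gamma_ratio_sq_le (by linarith : 0 < ((d : ℝ) - 1) / 2)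
  have hl := le_gamma_ratio_sq (by linarith : 1 / 2 < ((d : ℝ) - 1) / 2)
  have e : c1 d ^ 2 =
      (Real.Gamma (((d : ℝ) - 1) / 2 + 1 / 2) / Real.Gamma (((d : ℝ) - 1) / 2)) ^ 2 / Real.pi := by
    rw [show ((d : ℝ) - 1) / 2 + 1 / 2 = d / 2 by ring, c1, mul_comm (√Real.pi), ← div_div, div_pow,
      Real.sq_sqrt Real.pi_pos.le]
  rw [e]
  constructor
  · rw [← div_div]
    gcongr
    linarith
  · rw [← div_div]
    gcongr

theorem c2_pos {d : ℕ} (hd : 3 ≤ d) : 0 < c2 d := by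
  have h3 : (3 : ℝ) ≤ d := by exact_mod_cast hd
  have h1 := Real.Gamma_pos_of_pos (by nlinarith : 0 < ((d : ℝ) ^ 2 - 2 * (d : ℝ) + 2) / 2)
  have h2 := Real.Gamma_pos_of_pos (by nlinarith : 0 < ((d : ℝ) ^ 2 - 2 * (d : ℝ) + 1) / 2)
  unfold c2
  positivity

theorem c2_sq_bounds {d : ℕ} (hd : 3 ≤ d) :
    1 / Real.pi ≤ c2 d ^ 2 ∧ c2 d ^ 2 ≤ (d : ℝ) ^ 2 / Real.pi := by
  have h3 : (3 : ℝ) ≤ d := by exact_mod_cast hd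
  have hu := gamma_ratio_sq_le (by nlinarith : 0 < ((d : ℝ) ^ 2 - 2 * (d : ℝ) + 1) / 2)
  have hl := le_gamma_ratio_sq (by nlinarith : 1 / 2 < ((d : ℝ) ^ 2 - 2 * (d : ℝ) + 1) / 2)
  have e : c2 d ^ 2 = (Real.Gamma (((d : ℝ) ^ 2 - 2 * (d : ℝ) + 1) / 2 + 1 / 2) /
      Real.Gamma (((d : ℝ) ^ 2 - 2 * (d : ℝ) + 1) / 2)) ^ 2 / Real.pi := by
    rw [show ((d : ℝ) ^ 2 - 2 * (d : ℝ) + 1) / 2 + 1 / 2 = ((d : ℝ) ^ 2 - 2 * (d : ℝ) + 2) / 2 by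
      ring, c2, mul_comm (√Real.pi), ← div_div, div_pow, Real.sq_sqrt Real.pi_pos.le]
  rw [e]
  constructor
  · refine div_le_div_of_nonneg_right (le_trans ?_ hl) Real.pi_pos.le
    nlinarith
  · refine div_le_div_of_nonneg_right (hu.trans ?_) Real.pi_pos.le
    nlinarith

theorem tendsto_log_nat_div : Tendsto (fun d : ℕ => Real.log d / d) atTop (𝓝 0) :=
  (Real.isLittleO_log_id_atTop.tendsto_div_nhds_zero).comp tendsto_natCast_atTop_atTop

theorem tendsto_const_div_nat (c : ℝ) : Tendsto (fun d : ℕ => c / d) atTop (𝓝 0) :=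
  tendsto_const_div_atTop_nhds_zero_nat c

theorem tendsto_c1_div_sqrt :
    Tendsto (fun d : ℕ => c1 d / √d) atTop (𝓝 (√(2 * Real.pi))⁻¹) := by
  have hsq : Tendsto (fun d : ℕ => c1 d ^ 2 / d) atTop (𝓝 (1 / (2 * Real.pi))) := by
    have l1 : Tendsto (fun d : ℕ => (1 - 2 / (d : ℝ)) / (2 * Real.pi)) atTop
        (𝓝 (1 / (2 * Real.pi))) := by
      simpa using ((tendsto_const_div_nat 2).const_sub 1).div_const (2 * Real.pi)
    have l2 : Tendsto (fun d : ℕ => (1 - 1 / (d : ℝ)) / (2 * Real.pi)) atTop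
        (𝓝 (1 / (2 * Real.pi))) := by
      simpa using ((tendsto_const_div_nat 1).const_sub 1).div_const (2 * Real.pi)
    refine tendsto_of_tendsto_of_tendsto_of_le_of_le' l1 l2 ?_ ?_
    · filter_upwards [eventually_ge_atTop 3] with d hd
      have h3 : (3 : ℝ) ≤ d := by exact_mod_cast hd
      have := (c1_sq_bounds hd).1
      rw [le_div_iff₀ (by linarith)]
      refine (le_of_eq ?_).trans this
      rw [div_mul_eq_mul_div, sub_mul, one_mul, div_mul_cancel₀ _ (by linarith)]
    · filter_upwards [eventually_ge_atTop 3] with d hd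
      have h3 : (3 : ℝ) ≤ d := by exact_mod_cast hd
      have := (c1_sq_bounds hd).2
      rw [div_le_iff₀ (by linarith)]
      refine this.trans (le_of_eq ?_)
      rw [div_mul_eq_mul_div, sub_mul, one_mul, div_mul_cancel₀ _ (by linarith)]
  have h := (Real.continuous_sqrt.tendsto _).comp hsq
  rw [one_div, Real.sqrt_inv] at h
  refine h.congr' ?_
  filter_upwards [eventually_ge_atTop 3] with d hd
  simp only [Function.comp]
  rw [Real.sqrt_div (sq_nonneg _), Real.sqrt_sq (c1_pos (by omega)).le]

theorem tendsto_log_c2_div : Tendsto (fun d : ℕ => Real.log (c2 d) / d) atTop (𝓝 0) := by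
  have l1 : Tendsto (fun d : ℕ => (-(Real.log Real.pi / 2)) / (d : ℝ)) atTop (𝓝 0) :=
    tendsto_const_div_nat _
  have l2 : Tendsto (fun d : ℕ => Real.log d / d - (Real.log Real.pi / 2) / (d : ℝ)) atTop
      (𝓝 0) := by
    simpa using tendsto_log_nat_div.sub (tendsto_const_div_nat (Real.log Real.pi / 2))
  refine tendsto_of_tendsto_of_tendsto_of_le_of_le' l1 l2 ?_ ?_
  · filter_upwards [eventually_ge_atTop 3] with d hd
    have h := Real.log_le_log (by positivity) (c2_sq_bounds hd).1
    rw [one_div, Real.log_inv, Real.log_pow] at h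
    push_cast at h
    gcongr
    linarith
  · filter_upwards [eventually_ge_atTop 3] with d hd
    have h3 : (3 : ℝ) ≤ d := by exact_mod_cast hd
    have hc := c2_pos hd
    have h := Real.log_le_log (by positivity) (c2_sq_bounds hd).2
    rw [Real.log_div (by positivity) Real.pi_pos.ne', Real.log_pow, Real.log_pow] at h
    push_cast at h
    rw [← sub_div]
    gcongr
    linarith

/-! ### The standard normal distribution function -/

theorem integrable_gaussian_weight : Integrable (fun s : ℝ => Real.exp (-s ^ 2 / 2)) := by
  refine (integrable_exp_neg_mul_sq (by norm_num : (0 : ℝ) < 1 / 2)).congr (.of_forall fun s => ?_)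
  simp only
  congr 1
  ring

theorem integral_gaussian_weight : ∫ s : ℝ, Real.exp (-s ^ 2 / 2) = √(2 * Real.pi) := by
  have h := integral_gaussian (1 / 2)
  rw [show Real.pi / (1 / 2) = 2 * Real.pi by ring] at h
  rw [← h]
  congr 1 with s
  congr 1
  ring

theorem integral_Ioi_gaussian_weight :
    ∫ s in Set.Ioi (0 : ℝ), Real.exp (-s ^ 2 / 2) = √(2 * Real.pi) / 2 := by
  have h := integral_gaussian_Ioi (1 / 2)
  rw [show Real.pi / (1 / 2) = 2 * Real.pi by ring] at h
  rw [← h]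
  congr 1 with s
  congr 1
  ring

theorem integral_Ioi_gaussian_weight_le {r : ℝ} (hr : 0 ≤ r) :
    ∫ s in Set.Ioi r, Real.exp (-s ^ 2 / 2) ≤ Real.exp (-r ^ 2 / 2) * (√(2 * Real.pi) / 2) := by
  rw [← integral_Ioi_gaussian_weight, ← integral_const_mul, ← integral_indicator measurableSet_Ioi,
    ← integral_indicator measurableSet_Ioi,
    ← integral_add_right_eq_self ((Set.Ioi r).indicator _) r]
  refine integral_mono ?_ ?_ ?_
  · exact (integrable_gaussian_weight.indicator measurableSet_Ioi).comp_add_right r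
  · exact (integrable_gaussian_weight.const_mul _).indicator measurableSet_Ioi
  · intro s
    by_cases hs : 0 < s
    · simp only [Set.indicator, Set.mem_Ioi, lt_add_iff_pos_left, hs, if_true, ← Real.exp_add]
      gcongr
      nlinarith
    · simp [Set.indicator, hs]

theorem one_sub_stdPhi_le {r : ℝ} (hr : 0 ≤ r) : 1 - stdPhi r ≤ Real.exp (-r ^ 2 / 2) / 2 := by
  have h := integral_Ioi_gaussian_weight_le hr
  have hs := intervalIntegral.integral_Iic_add_Ioi (b := r)
    integrable_gaussian_weight.integrableOn integrable_gaussian_weight.integrableOn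
  rw [integral_gaussian_weight] at hs
  have hp : 0 < √(2 * Real.pi) := by positivity
  unfold stdPhi
  rw [eq_sub_of_add_eq hs, mul_sub, inv_mul_cancel₀ hp.ne', sub_sub_cancel, inv_mul_le_iff₀ hp]
  linarith

theorem half_le_stdPhi {r : ℝ} (hr : 0 ≤ r) : 1 / 2 ≤ stdPhi r := by
  have h1 := one_sub_stdPhi_le hr
  have h2 : Real.exp (-r ^ 2 / 2) ≤ 1 := by
    rw [Real.exp_le_one_iff]; nlinarith
  linarith

theorem stdPhi_le_one (r : ℝ) : stdPhi r ≤ 1 := by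
  have hp : 0 < √(2 * Real.pi) := by positivity
  unfold stdPhi
  rw [inv_mul_le_iff₀ hp, mul_one, ← integral_gaussian_weight]
  exact setIntegral_le_integral integrable_gaussian_weight (.of_forall fun s => (Real.exp_pos _).le)

theorem stdPhi_pos (r : ℝ) : 0 < stdPhi r := by
  unfold stdPhi
  refine mul_pos (by positivity) ?_
  rw [setIntegral_pos_iff_support_of_nonneg_ae (.of_forall fun s => (Real.exp_pos _).le)
    integrable_gaussian_weight.integrableOn]
  have : Function.support (fun s : ℝ => Real.exp (-s ^ 2 / 2)) = Set.univ := by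
    ext s; simp [Real.exp_ne_zero]
  simp [this]

theorem abs_log_stdPhi_le {r : ℝ} (hr : 0 ≤ r) : |Real.log (stdPhi r)| ≤ Real.log 2 := by
  rw [abs_of_nonpos (Real.log_nonpos (stdPhi_pos r).le (stdPhi_le_one r)), neg_le,
    ← Real.log_inv]
  exact Real.log_le_log (by norm_num) (by simpa using half_le_stdPhi hr)

theorem exists_grho_pos {ρ : ℝ} (hρ : 0 < ρ) : ∃ r, 0 < grho ρ r := by
  have hL : 0 < Real.log (1 + ρ) := Real.log_pos (by linarith)
  refine ⟨√(2 * Real.log (1 + ρ)), ?_⟩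
  set r := √(2 * Real.log (1 + ρ)) with hr
  have hr2 : r ^ 2 = 2 * Real.log (1 + ρ) := Real.sq_sqrt (by positivity)
  have h := one_sub_stdPhi_le (Real.sqrt_nonneg (2 * Real.log (1 + ρ)))
  rw [← hr, hr2, show -(2 * Real.log (1 + ρ)) / 2 = -Real.log (1 + ρ) by ring, Real.exp_neg,
    Real.exp_log (by linarith)] at h
  have hi : 0 < (1 + ρ)⁻¹ := by positivity
  have h1 : ρ / (1 + ρ) < stdPhi r := by
    have : ρ / (1 + ρ) = 1 - (1 + ρ)⁻¹ := by field_simp; ring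
    linarith
  have h2 := Real.log_lt_log (by positivity) h1
  rw [Real.log_div hρ.ne' (by linarith)] at h2
  unfold grho
  rw [hr2, add_comm ρ 1]
  nlinarith

/-! ### Convergence of the cap measure to the normal distribution -/

/-- The normalised measure of the spherical cap `{x | x₁ ≤ h}` on the unit sphere of `ℝ^d`. -/
noncomputable def capCdf (d : ℕ) (h : ℝ) : ℝ :=
  c1 d * ∫ s in (-1 : ℝ)..h, (1 - s ^ 2) ^ (((d : ℝ) - 3) / 2)

/-- The density of `√d` times a coordinate of a uniform random point of the sphere. -/
noncomputable def scaledDensity (d : ℕ) : ℝ → ℝ :=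
  (Set.Ioc (-√(d : ℝ)) √(d : ℝ)).indicator
    fun u => c1 d / √d * (1 - u ^ 2 / d) ^ (((d : ℝ) - 3) / 2)

theorem capCdf_eq_integral_scaledDensity {d : ℕ} (hd : 0 < d) {h : ℝ} (hl : -1 ≤ h)
    (hu : h ≤ 1) : capCdf d h = ∫ u in Set.Iic (h * √d), scaledDensity d u := by
  have hs : 0 < √(d : ℝ) := by positivity
  have hset : Set.Iic (h * √d) ∩ Set.Ioc (-√(d : ℝ)) √(d : ℝ) = Set.Ioc (-√(d : ℝ)) (h * √d) := by
    ext u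
    simp only [Set.mem_inter_iff, Set.mem_Iic, Set.mem_Ioc]
    constructor
    · rintro ⟨h1, h2, -⟩
      exact ⟨h2, h1⟩
    · rintro ⟨h1, h2⟩
      exact ⟨h2, h1, by nlinarith⟩
  rw [scaledDensity, setIntegral_indicator measurableSet_Ioc, hset,
    ← intervalIntegral.integral_of_le (by nlinarith), intervalIntegral.integral_const_mul]
  have e := intervalIntegral.integral_comp_div (a := -√(d : ℝ)) (b := h * √d)
    (fun s : ℝ => (1 - s ^ 2) ^ (((d : ℝ) - 3) / 2)) hs.ne'
  simp only [div_pow, Real.sq_sqrt (Nat.cast_nonneg d), smul_eq_mul, neg_div, div_self hs.ne',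
    mul_div_cancel_right₀ _ hs.ne'] at e
  rw [e, capCdf]
  field_simp

theorem tendsto_nat_mul_log_one_sub_div (t : ℝ) :
    Tendsto (fun d : ℕ => (d : ℝ) * Real.log (1 - t / d)) atTop (𝓝 (-t)) := by
  have h := (Real.tendsto_mul_log_one_add_div_atTop (-t)).comp
    (tendsto_natCast_atTop_atTop (R := ℝ))
  simpa [Function.comp_def, neg_div, ← sub_eq_add_neg] using h

theorem tendsto_scaledDensity (u : ℝ) : Tendsto (fun d => scaledDensity d u) atTop
    (𝓝 ((√(2 * Real.pi))⁻¹ * Real.exp (-u ^ 2 / 2))) := by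
  have h1 : Tendsto (fun d : ℕ => (d : ℝ) * Real.log (1 - u ^ 2 / d) * ((1 - 3 / (d : ℝ)) / 2))
      atTop (𝓝 (-u ^ 2 / 2)) := by
    have h := (tendsto_nat_mul_log_one_sub_div (u ^ 2)).mul
      (((tendsto_const_div_nat 3).const_sub 1).div_const 2)
    simpa [div_eq_mul_inv] using h
  have h2 := tendsto_c1_div_sqrt.mul ((Real.continuous_exp.tendsto _).comp h1)
  refine h2.congr' ?_
  have hlarge : ∀ᶠ d : ℕ in atTop, u ^ 2 < d :=
    (tendsto_natCast_atTop_atTop (R := ℝ)).eventually_gt_atTop _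
  filter_upwards [hlarge, eventually_gt_atTop 0] with d hd h0
  have hd0 : (0 : ℝ) < d := by exact_mod_cast h0
  have habs := abs_lt.1 (Real.lt_sqrt (abs_nonneg u) |>.2 (by rwa [sq_abs]))
  have hb : 0 < 1 - u ^ 2 / d := by
    rw [sub_pos, div_lt_one hd0]; exact hd
  have hmem : u ∈ Set.Ioc (-√(d : ℝ)) √(d : ℝ) := ⟨habs.1, habs.2.le⟩
  rw [scaledDensity, Set.indicator_of_mem hmem, Real.rpow_def_of_pos hb]
  simp only [Function.comp]
  congr 2
  field_simp

theorem one_sub_rpow_le_exp {x p : ℝ} (hx : x ≤ 1) (hp : 0 ≤ p) :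
    (1 - x) ^ p ≤ Real.exp (-(x * p)) := by
  calc (1 - x) ^ p ≤ Real.exp (-x) ^ p :=
        Real.rpow_le_rpow (by linarith) (Real.one_sub_le_exp_neg x) hp
    _ = Real.exp (-(x * p)) := by rw [← Real.exp_mul]; ring_nf

theorem scaledDensity_nonneg {d : ℕ} (hd : 2 ≤ d) (u : ℝ) : 0 ≤ scaledDensity d u := by
  refine Set.indicator_nonneg (fun u hu => ?_) u
  have hd0 : (0 : ℝ) < d := by exact_mod_cast (by omega : 0 < d)
  have h1 : u ^ 2 ≤ d := by
    rw [← Real.sq_sqrt hd0.le]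
    exact sq_le_sq' hu.1.le hu.2
  have h2 : 0 ≤ 1 - u ^ 2 / d := by
    rw [sub_nonneg, div_le_one hd0]; exact h1
  have := c1_pos hd
  positivity

theorem eventually_scaledDensity_le :
    ∀ᶠ d : ℕ in atTop, ∀ u, scaledDensity d u ≤ Real.exp (-(1 / 4) * u ^ 2) := by
  have hlt : (√(2 * Real.pi))⁻¹ < 1 := by
    apply inv_lt_one_of_one_lt₀
    rw [Real.lt_sqrt (by norm_num)]
    linarith [Real.pi_gt_three]
  filter_upwards [tendsto_c1_div_sqrt.eventually_lt_const hlt, eventually_ge_atTop 6] with d hc hd u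
  have hd6 : (6 : ℝ) ≤ d := by exact_mod_cast hd
  have hd0 : (0 : ℝ) < d := by linarith
  refine Set.indicator_apply_le' (fun hu => ?_) fun _ => (Real.exp_pos _).le
  have h1 : u ^ 2 / d ≤ 1 := by
    rw [div_le_one hd0, ← Real.sq_sqrt hd0.le]
    exact sq_le_sq' hu.1.le hu.2
  have h2 := one_sub_rpow_le_exp h1 (by linarith : 0 ≤ ((d : ℝ) - 3) / 2)
  have h3 : (1 / 4) * u ^ 2 ≤ u ^ 2 / d * (((d : ℝ) - 3) / 2) := by
    rw [div_mul_eq_mul_div (u ^ 2), le_div_iff₀ hd0]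
    nlinarith [sq_nonneg u]
  calc c1 d / √d * (1 - u ^ 2 / d) ^ (((d : ℝ) - 3) / 2)
      ≤ 1 * (1 - u ^ 2 / d) ^ (((d : ℝ) - 3) / 2) :=
        mul_le_mul_of_nonneg_right hc.le (Real.rpow_nonneg (by linarith) _)
    _ ≤ Real.exp (-(1 / 4) * u ^ 2) := by
        rw [one_mul]
        refine h2.trans (Real.exp_le_exp.2 ?_)
        linarith

theorem measurable_scaledDensity (d : ℕ) : Measurable (scaledDensity d) := by
  refine Measurable.indicator ?_ measurableSet_Ioc
  fun_prop

theorem tendsto_integral_abs_scaledDensity_sub :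
    Tendsto (fun d => ∫ u, |scaledDensity d u - (√(2 * Real.pi))⁻¹ * Real.exp (-u ^ 2 / 2)|)
      atTop (𝓝 0) := by
  have h := tendsto_integral_filter_of_dominated_convergence (μ := volume) (l := atTop)
    (F := fun (d : ℕ) u => |scaledDensity d u - (√(2 * Real.pi))⁻¹ * Real.exp (-u ^ 2 / 2)|)
    (f := fun _ => (0 : ℝ))
    (fun u => Real.exp (-(1 / 4) * u ^ 2) + (√(2 * Real.pi))⁻¹ * Real.exp (-u ^ 2 / 2)) ?_ ?_ ?_ ?_
  · simpa using h
  · refine .of_forall fun d => Measurable.aestronglyMeasurable ?_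
    have := measurable_scaledDensity d
    fun_prop
  · filter_upwards [eventually_scaledDensity_le, eventually_ge_atTop 2] with d h1 h2
    refine .of_forall fun u => ?_
    have h3 := scaledDensity_nonneg h2 u
    have h4 : 0 ≤ (√(2 * Real.pi))⁻¹ * Real.exp (-u ^ 2 / 2) := by positivity
    rw [Real.norm_eq_abs, abs_abs]
    have h5 := h1 u
    rw [abs_le]
    constructor <;> linarith [Real.exp_pos (-(1 / 4) * u ^ 2)]
  · exact (integrable_exp_neg_mul_sq (by norm_num)).add (integrable_gaussian_weight.const_mul _)
  · refine .of_forall fun u => ?_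
    have h := ((tendsto_scaledDensity u).sub_const ((√(2 * Real.pi))⁻¹ * Real.exp (-u ^ 2 / 2))).abs
    rwa [sub_self, abs_zero] at h

theorem eventually_integrable_scaledDensity : ∀ᶠ d in atTop, Integrable (scaledDensity d) := by
  filter_upwards [eventually_scaledDensity_le, eventually_ge_atTop 2] with d h1 h2
  refine (integrable_exp_neg_mul_sq (by norm_num : (0 : ℝ) < 1 / 4)).mono'
    (measurable_scaledDensity d).aestronglyMeasurable (.of_forall fun u => ?_)
  rw [Real.norm_eq_abs, abs_of_nonneg (scaledDensity_nonneg h2 u)]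
  exact h1 u

theorem eventually_abs_capCdf_sub_stdPhi_lt {ε : ℝ} (hε : 0 < ε) :
    ∀ᶠ d in atTop, ∀ h ∈ Set.Icc (-1 : ℝ) 1, |capCdf d h - stdPhi (h * √d)| < ε := by
  filter_upwards [tendsto_integral_abs_scaledDensity_sub.eventually_lt_const hε,
    eventually_integrable_scaledDensity, eventually_gt_atTop 0] with d h1 h2 h3 h hh
  have hi := integrable_gaussian_weight.const_mul (√(2 * Real.pi))⁻¹
  rw [capCdf_eq_integral_scaledDensity h3 hh.1 hh.2, stdPhi, ← integral_const_mul,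
    ← integral_sub h2.integrableOn hi.integrableOn]
  refine (abs_integral_le_integral_abs.trans ?_).trans_lt h1
  exact setIntegral_le_integral (h2.sub hi).abs (.of_forall fun u => abs_nonneg _)

theorem tendsto_capCdf (r : ℝ) :
    Tendsto (fun d : ℕ => capCdf d (r / √d)) atTop (𝓝 (stdPhi r)) := by
  rw [Metric.tendsto_nhds]
  intro ε hε
  have hlarge : ∀ᶠ d : ℕ in atTop, r ^ 2 < d :=
    (tendsto_natCast_atTop_atTop (R := ℝ)).eventually_gt_atTop _
  filter_upwards [eventually_abs_capCdf_sub_stdPhi_lt hε, hlarge, eventually_gt_atTop 0]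
    with d h1 h2 h3
  have hd0 : (0 : ℝ) < d := by exact_mod_cast h3
  have hs := Real.sqrt_pos.2 hd0
  have habs := abs_lt.1 (Real.lt_sqrt (abs_nonneg r) |>.2 (by rwa [sq_abs]))
  have h := h1 (r / √d) ⟨by rw [le_div_iff₀ hs]; linarith, by rw [div_le_one hs]; exact habs.2.le⟩
  rwa [div_mul_cancel₀ _ hs.ne'] at h

theorem continuous_capCdf {d : ℕ} (hd : 3 ≤ d) : Continuous (capCdf d) := by
  have h3 : (3 : ℝ) ≤ d := by exact_mod_cast hd
  have hc : Continuous fun s : ℝ => (1 - s ^ 2) ^ (((d : ℝ) - 3) / 2) :=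
    Continuous.rpow_const (by fun_prop) fun _ => Or.inr (by linarith)
  exact continuous_const.mul
    (intervalIntegral.continuous_primitive (fun a b => hc.intervalIntegrable a b) _)

theorem capCdf_mono {d : ℕ} (hd : 3 ≤ d) {a b : ℝ} (ha : -1 ≤ a) (hab : a ≤ b) (hb : b ≤ 1) :
    capCdf d a ≤ capCdf d b := by
  have h3 : (3 : ℝ) ≤ d := by exact_mod_cast hd
  have hc : Continuous fun s : ℝ => (1 - s ^ 2) ^ (((d : ℝ) - 3) / 2) :=
    Continuous.rpow_const (by fun_prop) fun _ => Or.inr (by linarith)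
  refine mul_le_mul_of_nonneg_left ?_ (c1_pos (by omega)).le
  refine intervalIntegral.integral_mono_interval le_rfl ha hab ?_ (hc.intervalIntegrable _ _)
  refine (ae_restrict_iff' measurableSet_Ioc).2 (.of_forall fun s hs => ?_)
  exact Real.rpow_nonneg (by nlinarith [hs.1, hs.2]) _

theorem capCdf_nonneg {d : ℕ} (hd : 3 ≤ d) {h : ℝ} (hl : -1 ≤ h) (hu : h ≤ 1) :
    0 ≤ capCdf d h := by
  refine le_of_eq_of_le ?_ (capCdf_mono hd le_rfl hl hu)
  simp [capCdf]

/-! ### The binomial coefficient -/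

theorem tendsto_log_factorial_error_div :
    Tendsto (fun n : ℕ => (Real.log n.factorial - (n * Real.log n - n)) / n) atTop (𝓝 0) := by
  have h1 : Tendsto (fun n : ℕ => Real.log (Stirling.stirlingSeq n)) atTop
      (𝓝 (Real.log √Real.pi)) :=
    Stirling.tendsto_stirlingSeq_sqrt_pi.log (by positivity)
  have h2 := h1.div_atTop (tendsto_natCast_atTop_atTop (R := ℝ))
  have h3 := (h2.add (tendsto_const_div_nat (1 / 2 * Real.log 2))).add
    (tendsto_log_nat_div.const_mul (1 / 2))
  simp only [add_zero, mul_zero] at h3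
  refine h3.congr' ?_
  filter_upwards [eventually_gt_atTop 0] with n hn
  have hn0 : (0 : ℝ) < n := by exact_mod_cast hn
  rw [Stirling.log_stirlingSeq_formula, Real.log_mul (by norm_num) hn0.ne',
    Real.log_div hn0.ne' (Real.exp_ne_zero _), Real.log_exp]
  field_simp
  ring

theorem tendsto_natCast_sub_div {d : ℕ → ℕ} {ρ : ℝ}
    (hd : ∀ᶠ n in atTop, 2 ≤ d n ∧ d n < n)
    (hreg : Tendsto (fun n : ℕ => ((n : ℝ) - (d n : ℝ)) / (d n : ℝ)) atTop (𝓝 ρ)) :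
    Tendsto (fun n : ℕ => ((n - d n : ℕ) : ℝ) / (d n : ℝ)) atTop (𝓝 ρ) := by
  refine hreg.congr' ?_
  filter_upwards [hd] with n hn
  rw [Nat.cast_sub hn.2.le]

theorem tendsto_log_choose_div {d : ℕ → ℕ} {ρ : ℝ} (hρ : 0 < ρ)
    (hd : ∀ᶠ n in atTop, 2 ≤ d n ∧ d n < n) (hdi : Tendsto d atTop atTop)
    (hreg : Tendsto (fun n : ℕ => ((n : ℝ) - (d n : ℝ)) / (d n : ℝ)) atTop (𝓝 ρ)) :
    Tendsto (fun n : ℕ => Real.log (n.choose (d n)) / (d n : ℝ)) atTop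
      (𝓝 ((ρ + 1) * Real.log (ρ + 1) - ρ * Real.log ρ)) := by
  have hm := tendsto_natCast_sub_div hd hreg
  have hdr : Tendsto (fun n => (d n : ℝ)) atTop atTop := tendsto_natCast_atTop_atTop.comp hdi
  have hmi : Tendsto (fun n : ℕ => n - d n) atTop atTop := by
    rw [← tendsto_natCast_atTop_iff (R := ℝ)]
    refine (hm.pos_mul_atTop hρ hdr).congr' ?_
    filter_upwards [hd] with n hn
    have : (d n : ℝ) ≠ 0 := by exact_mod_cast (by omega : d n ≠ 0)
    rw [div_mul_cancel₀ _ this]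
  have hn : Tendsto (fun n : ℕ => (n : ℝ) / (d n : ℝ)) atTop (𝓝 (ρ + 1)) := by
    refine (hreg.add_const 1).congr' ?_
    filter_upwards [hd] with n hn
    have : (d n : ℝ) ≠ 0 := by exact_mod_cast (by omega : d n ≠ 0)
    field_simp
    ring
  have e1 := tendsto_log_factorial_error_div.mul hn
  have e2 := tendsto_log_factorial_error_div.comp hdi
  have e3 := (tendsto_log_factorial_error_div.comp hmi).mul hm
  have main := (hn.mul (hn.log (by linarith))).sub (hm.mul (hm.log hρ.ne'))
  have key := ((main.add e1).sub e2).sub e3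
  simp only [zero_mul, add_zero, sub_zero] at key
  refine key.congr' ?_
  filter_upwards [hd] with n hn
  have h1 : (d n : ℝ) ≠ 0 := by exact_mod_cast (by omega : d n ≠ 0)
  have h2 : (n : ℝ) ≠ 0 := by exact_mod_cast (by omega : n ≠ 0)
  have h3 : ((n - d n : ℕ) : ℝ) ≠ 0 := by exact_mod_cast (by omega : n - d n ≠ 0)
  have hsum : (n : ℝ) = d n + ((n - d n : ℕ) : ℝ) := by
    rw [Nat.cast_sub hn.2.le]; ring
  rw [Nat.cast_choose ℝ hn.2.le, Real.log_div h2 h1, Real.log_div h3 h1,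
    Real.log_div (by positivity) (by positivity), Real.log_mul (by positivity) (by positivity)]
  simp only [Function.comp]
  generalize ((n - d n : ℕ) : ℝ) = m at *
  generalize Real.log (n - d n).factorial = fm
  generalize Real.log n = ln
  generalize Real.log n.factorial = fn
  generalize (n : ℝ) = N at *
  subst hsum
  field_simp
  ring

/-! ### The integral -/

theorem continuous_facet_integrand {d : ℕ} (hd : 3 ≤ d) (m : ℕ) :
    Continuous fun h : ℝ =>
      (1 - h ^ 2) ^ (((d : ℝ) ^ 2 - 2 * (d : ℝ) - 1) / 2) * capCdf d h ^ m := by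
  have h3 : (3 : ℝ) ≤ d := by exact_mod_cast hd
  refine Continuous.mul ?_ ((continuous_capCdf hd).pow m)
  exact Continuous.rpow_const (by fun_prop) fun _ => Or.inr (by nlinarith)

theorem facet_integrand_le {d : ℕ} (hd : 4 ≤ d) (m : ℕ) {δ ρ K : ℝ}
    (hcap : ∀ h ∈ Set.Icc (-1 : ℝ) 1, |capCdf d h - stdPhi (h * √d)| < δ)
    (hK : ∀ r : ℝ, -r ^ 2 / 2 + ρ * Real.log (stdPhi r) ≤ K) {h : ℝ}
    (hh : h ∈ Set.Icc (-1 : ℝ) 1) :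
    (1 - h ^ 2) ^ (((d : ℝ) ^ 2 - 2 * (d : ℝ) - 1) / 2) * capCdf d h ^ m ≤
      Real.exp (((d : ℝ) - 3) * K + |(m : ℝ) - ρ * (d - 3)| * Real.log 2 + 2 * δ * m) := by
  have h4 : (4 : ℝ) ≤ d := by exact_mod_cast hd
  have hd0 : (0 : ℝ) ≤ d := by linarith
  set p := max h 0 with hp
  have hp0 : 0 ≤ p := le_max_right _ _
  have hhp : h ≤ p := le_max_left _ _
  have hp1 : p ≤ 1 := max_le hh.2 zero_le_one
  have hpsq : p ^ 2 ≤ h ^ 2 := by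
    rcases max_cases h 0 with ⟨e, -⟩ | ⟨e, -⟩ <;> rw [hp, e]
    nlinarith
  have hδ : 0 < δ := (abs_nonneg _).trans_lt (hcap h hh)
  set r := p * √d with hr
  have hr0 : 0 ≤ r := by positivity
  have hr2 : r ^ 2 = p ^ 2 * d := by rw [hr, mul_pow, Real.sq_sqrt hd0]
  have hhalf := half_le_stdPhi hr0
  have hlog := abs_log_stdPhi_le hr0
  have hcapr : capCdf d h ≤ Real.exp (Real.log (stdPhi r) + 2 * δ) := by
    rw [Real.exp_add, Real.exp_log (stdPhi_pos r)]
    have h1 := capCdf_mono (by omega : 3 ≤ d) hh.1 hhp hp1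
    have h2 := (abs_lt.1 (hcap p ⟨by linarith, hp1⟩)).2
    rw [← hr] at h2
    have h3 := mul_le_mul_of_nonneg_left (Real.add_one_le_exp (2 * δ)) (stdPhi_pos r).le
    nlinarith
  have hpow : capCdf d h ^ m ≤ Real.exp (m * (Real.log (stdPhi r) + 2 * δ)) := by
    rw [Real.exp_nat_mul]
    exact pow_le_pow_left₀ (capCdf_nonneg (by omega) hh.1 hh.2) hcapr m
  have hA : 0 ≤ ((d : ℝ) ^ 2 - 2 * (d : ℝ) - 1) / 2 := by nlinarith
  have hw := one_sub_rpow_le_exp (by nlinarith [hh.1, hh.2] : h ^ 2 ≤ 1) hA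
  have hw2 : r ^ 2 * (d - 3) / 2 ≤ h ^ 2 * (((d : ℝ) ^ 2 - 2 * (d : ℝ) - 1) / 2) := by
    rw [hr2]
    have h1 : p ^ 2 * (d * (d - 3)) ≤ h ^ 2 * ((d : ℝ) ^ 2 - 2 * (d : ℝ) - 1) :=
      mul_le_mul hpsq (by nlinarith) (by nlinarith) (sq_nonneg _)
    linarith
  have hcross : ((m : ℝ) - ρ * (d - 3)) * Real.log (stdPhi r) ≤
      |(m : ℝ) - ρ * (d - 3)| * Real.log 2 :=
    (le_abs_self _).trans ((abs_mul _ _).trans_le (mul_le_mul_of_nonneg_left hlog (abs_nonneg _)))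
  have hKr := mul_le_mul_of_nonneg_left (hK r) (by linarith : (0 : ℝ) ≤ d - 3)
  calc _ ≤ Real.exp (-(h ^ 2 * (((d : ℝ) ^ 2 - 2 * (d : ℝ) - 1) / 2))) *
        Real.exp (m * (Real.log (stdPhi r) + 2 * δ)) :=
        mul_le_mul hw hpow (pow_nonneg (capCdf_nonneg (by omega) hh.1 hh.2) m) (Real.exp_pos _).le
    _ ≤ _ := by
        rw [← Real.exp_add]
        apply Real.exp_le_exp.2
        linarith

theorem II_le {n d : ℕ} (hd : 4 ≤ d) {δ ρ K : ℝ}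
    (hcap : ∀ h ∈ Set.Icc (-1 : ℝ) 1, |capCdf d h - stdPhi (h * √d)| < δ)
    (hK : ∀ r : ℝ, -r ^ 2 / 2 + ρ * Real.log (stdPhi r) ≤ K) :
    II n d (-1) 1 ≤ 2 * Real.exp (((d : ℝ) - 3) * K +
      |((n - d : ℕ) : ℝ) - ρ * (d - 3)| * Real.log 2 + 2 * δ * ((n - d : ℕ) : ℝ)) := by
  have h := intervalIntegral.integral_mono_on (μ := volume) (by norm_num : (-1 : ℝ) ≤ 1)
    ((continuous_facet_integrand (by omega : 3 ≤ d) (n - d)).intervalIntegrable _ _)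
    (continuous_const.intervalIntegrable _ _)
    fun x hx => facet_integrand_le hd (n - d) hcap hK hx
  rw [intervalIntegral.integral_const, smul_eq_mul] at h
  norm_num at h
  exact h

theorem le_II {n d : ℕ} (hd : 3 ≤ d) {r δ : ℝ} (hδ : 0 < δ) (hR : (|r| + δ) ^ 2 < d) :
    δ / √d * ((1 - (|r| + δ) ^ 2 / d) ^ (((d : ℝ) ^ 2 - 2 * (d : ℝ) - 1) / 2) *
      capCdf d (r / √d) ^ (n - d)) ≤ II n d (-1) 1 := by
  have h3 : (3 : ℝ) ≤ d := by exact_mod_cast hd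
  have hd0 : (0 : ℝ) < d := by linarith
  have hs := Real.sqrt_pos.2 hd0
  have hA : 0 ≤ ((d : ℝ) ^ 2 - 2 * (d : ℝ) - 1) / 2 := by nlinarith
  have hRs : |r| + δ < √d := Real.lt_sqrt (by positivity) |>.2 hR
  have hr := abs_le.1 (le_refl |r|)
  have hlo : -1 ≤ r / √d := by rw [le_div_iff₀ hs]; linarith
  have hmid : r / √d ≤ (r + δ) / √d := by gcongr; linarith
  have hhi : (r + δ) / √d ≤ 1 := by rw [div_le_one hs]; linarith
  have hc := continuous_facet_integrand hd (n - d)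
  have h1 : ∫ h in (r / √d)..((r + δ) / √d),
      (1 - h ^ 2) ^ (((d : ℝ) ^ 2 - 2 * (d : ℝ) - 1) / 2) * capCdf d h ^ (n - d) ≤
      II n d (-1) 1 := by
    refine intervalIntegral.integral_mono_interval hlo hmid hhi ?_ (hc.intervalIntegrable _ _)
    refine (ae_restrict_iff' measurableSet_Ioc).2 (.of_forall fun s hs => ?_)
    exact mul_nonneg (Real.rpow_nonneg (by nlinarith [hs.1, hs.2]) _)
      (pow_nonneg (capCdf_nonneg hd hs.1.le hs.2) _)
  refine le_trans ?_ h1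
  have h2 := intervalIntegral.integral_mono_on (μ := volume) hmid
    (continuous_const.intervalIntegrable _ _) (hc.intervalIntegrable _ _)
    (f := fun _ => (1 - (|r| + δ) ^ 2 / d) ^ (((d : ℝ) ^ 2 - 2 * (d : ℝ) - 1) / 2) *
      capCdf d (r / √d) ^ (n - d)) fun x hx => ?_
  · rw [intervalIntegral.integral_const, smul_eq_mul, ← sub_div, add_sub_cancel_left] at h2
    exact h2
  · have hx1 : x ≤ 1 := hx.2.trans hhi
    have hxs1 := (div_le_iff₀ hs).1 hx.1
    have hxs2 := (le_div_iff₀ hs).1 hx.2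
    have hx2 : x ^ 2 ≤ (|r| + δ) ^ 2 / d := by
      rw [le_div_iff₀ hd0, ← Real.sq_sqrt hd0.le, ← mul_pow]
      exact sq_le_sq' (by linarith) (by linarith)
    have hR1 : (|r| + δ) ^ 2 / d ≤ 1 := by rw [div_le_one hd0]; exact hR.le
    refine mul_le_mul (Real.rpow_le_rpow (by linarith) (by linarith) hA)
      (pow_le_pow_left₀ (capCdf_nonneg hd hlo (hmid.trans hhi))
        (capCdf_mono hd hlo hx.1 hx1) _)
      (pow_nonneg (capCdf_nonneg hd hlo (hmid.trans hhi)) _)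
      (Real.rpow_nonneg (by linarith) _)

theorem eventually_le_log_II_div {d : ℕ → ℕ} {ρ : ℝ}
    (hd : ∀ᶠ n in atTop, 2 ≤ d n ∧ d n < n) (hdi : Tendsto d atTop atTop)
    (hreg : Tendsto (fun n : ℕ => ((n : ℝ) - (d n : ℝ)) / (d n : ℝ)) atTop (𝓝 ρ))
    {r c : ℝ} (hc : c < -r ^ 2 / 2 + ρ * Real.log (stdPhi r)) :
    ∀ᶠ n in atTop, 0 < II n (d n) (-1) 1 ∧ c < Real.log (II n (d n) (-1) 1) / d n := by
  have hm := tendsto_natCast_sub_div hd hreg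
  have hcont : Tendsto (fun δ : ℝ => -(|r| + δ) ^ 2 / 2 + ρ * Real.log (stdPhi r)) (𝓝[>] 0)
      (𝓝 (-r ^ 2 / 2 + ρ * Real.log (stdPhi r))) := by
    have h : Continuous fun δ : ℝ => -(|r| + δ) ^ 2 / 2 + ρ * Real.log (stdPhi r) := by fun_prop
    have h0 := (h.tendsto 0).mono_left (nhdsWithin_le_nhds (s := Set.Ioi 0))
    simpa using h0
  obtain ⟨δ, hδc, hδ⟩ := ((hcont.eventually_const_lt hc).and self_mem_nhdsWithin).exists
  have hδ : 0 < δ := hδ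
  have t1 : Tendsto (fun k : ℕ => Real.log δ / k - 1 / 2 * (Real.log k / k) +
      k * Real.log (1 - (|r| + δ) ^ 2 / k) *
        ((1 - 2 * (1 / (k : ℝ)) - (1 / (k : ℝ)) * (1 / (k : ℝ))) / 2)) atTop
      (𝓝 (-(|r| + δ) ^ 2 / 2)) := by
    have hi := tendsto_const_div_nat 1
    have h := ((tendsto_const_div_nat (Real.log δ)).sub (tendsto_log_nat_div.const_mul (1 / 2))).add
      ((tendsto_nat_mul_log_one_sub_div ((|r| + δ) ^ 2)).mul
        ((((hi.const_mul 2).const_sub 1).sub (hi.mul hi)).div_const 2))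
    convert h using 2
    ring
  have t2 := hm.mul (((tendsto_capCdf r).comp hdi).log (stdPhi_pos r).ne')
  have t3 := ((t1.comp hdi).add t2).eventually_const_lt hδc
  have hlarge : ∀ᶠ k : ℕ in atTop, (|r| + δ) ^ 2 < k :=
    (tendsto_natCast_atTop_atTop (R := ℝ)).eventually_gt_atTop _
  filter_upwards [t3, hdi.eventually hlarge, hdi.eventually (eventually_ge_atTop 3),
    hdi.eventually ((tendsto_capCdf r).eventually_const_lt (stdPhi_pos r))] with n h1 h2 h3 h4
  have hd3 : (3 : ℝ) ≤ d n := by exact_mod_cast h3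
  have hd0 : (0 : ℝ) < d n := by linarith
  have hb : 0 < 1 - (|r| + δ) ^ 2 / d n := by rw [sub_pos, div_lt_one hd0]; exact h2
  have hle := le_II (n := n) h3 hδ h2
  have hpos := Real.rpow_pos_of_pos hb (((d n : ℝ) ^ 2 - 2 * (d n : ℝ) - 1) / 2)
  have hpow := pow_pos h4 (n - d n)
  have hlow : 0 < δ / √(d n : ℝ) := by positivity
  refine ⟨(by positivity : (0 : ℝ) < _).trans_le hle, h1.trans_le ?_⟩
  have hlog := Real.log_le_log (by positivity) hle
  rw [Real.log_mul hlow.ne' (by positivity), Real.log_mul hpos.ne' hpow.ne', Real.log_rpow hb,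
    Real.log_pow, Real.log_div hδ.ne' (by positivity), Real.log_sqrt hd0.le] at hlog
  rw [le_div_iff₀ hd0]
  refine le_trans (le_of_eq ?_) hlog
  simp only [Function.comp]
  field_simp
  ring

theorem eventually_log_II_div_lt {d : ℕ → ℕ} {ρ K : ℝ}
    (hd : ∀ᶠ n in atTop, 2 ≤ d n ∧ d n < n) (hdi : Tendsto d atTop atTop)
    (hreg : Tendsto (fun n : ℕ => ((n : ℝ) - (d n : ℝ)) / (d n : ℝ)) atTop (𝓝 ρ))
    (hpos : ∀ᶠ n in atTop, 0 < II n (d n) (-1) 1)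
    (hK : ∀ r : ℝ, -r ^ 2 / 2 + ρ * Real.log (stdPhi r) ≤ K) {c : ℝ} (hc : K < c) :
    ∀ᶠ n in atTop, Real.log (II n (d n) (-1) 1) / d n < c := by
  have hm := tendsto_natCast_sub_div hd hreg
  have hcont : Tendsto (fun δ : ℝ => K + 2 * δ * ρ) (𝓝[>] 0) (𝓝 K) := by
    have h : Continuous fun δ : ℝ => K + 2 * δ * ρ := by fun_prop
    have h0 := (h.tendsto 0).mono_left (nhdsWithin_le_nhds (s := Set.Ioi 0))
    simpa using h0
  obtain ⟨δ, hδc, hδ⟩ := ((hcont.eventually_lt_const hc).and self_mem_nhdsWithin).exists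
  have hδ : 0 < δ := hδ
  have hi := (tendsto_const_div_nat 3).comp hdi
  have t : Tendsto (fun n => Real.log 2 / (d n : ℝ) + (1 - 3 / (d n : ℝ)) * K +
      |((n - d n : ℕ) : ℝ) / d n - ρ * (1 - 3 / (d n : ℝ))| * Real.log 2 +
      2 * δ * (((n - d n : ℕ) : ℝ) / d n)) atTop (𝓝 (K + 2 * δ * ρ)) := by
    have h := ((((tendsto_const_div_nat (Real.log 2)).comp hdi).add
      ((hi.const_sub 1).mul_const K)).add
      (((hm.sub ((hi.const_sub 1).const_mul ρ)).abs).mul_const (Real.log 2))).add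
      (hm.const_mul (2 * δ))
    simpa using h
  filter_upwards [t.eventually_lt_const hδc, hpos, hdi.eventually (eventually_ge_atTop 4),
    hdi.eventually (eventually_abs_capCdf_sub_stdPhi_lt hδ)] with n h1 h2 h3 h4
  have hd4 : (4 : ℝ) ≤ d n := by exact_mod_cast h3
  have hd0 : (0 : ℝ) < d n := by linarith
  have hle := Real.log_le_log h2 (II_le (n := n) h3 h4 hK)
  rw [Real.log_mul (by norm_num) (Real.exp_ne_zero _), Real.log_exp] at hle
  refine lt_of_le_of_lt ?_ h1
  rw [div_le_iff₀ hd0]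
  refine hle.trans (le_of_eq ?_)
  have habs : |((n - d n : ℕ) : ℝ) / d n - ρ * (1 - 3 / (d n : ℝ))| =
      |((n - d n : ℕ) : ℝ) - ρ * (d n - 3)| / d n := by
    rw [← abs_of_pos hd0, ← abs_div, abs_of_pos hd0]
    congr 1
    field_simp
  rw [habs]
  field_simp
  ring

/-- in the linear regime `(n-d)/d → ρ > 0`, the expected number of facets
satisfies `F = e^{dM + o(d)}` where `M = max g_ρ > 0`. -/
theorem facet_count_linear (d : ℕ → ℕ) (ρ : ℝ) (hρ : 0 < ρ)
    (hd : ∀ᶠ n in atTop, 2 ≤ d n ∧ d n < n)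
    (hdi : Tendsto (fun n : ℕ => (d n : ℝ)) atTop atTop)
    (hreg : Tendsto (fun n : ℕ => ((n : ℝ) - (d n : ℝ)) / (d n : ℝ)) atTop (nhds ρ))
    (M : ℝ) (hM : ∃ r₀ : ℝ, grho ρ r₀ = M ∧ ∀ r : ℝ, grho ρ r ≤ M) :
    0 < M ∧
    Tendsto (fun n : ℕ => Real.log (FF n (d n) (-1) 1) / (d n : ℝ)) atTop (nhds M) := by
  obtain ⟨r₀, hr₀, hmax⟩ := hM
  obtain ⟨r₁, hr₁⟩ := exists_grho_pos hρ
  refine ⟨hr₁.trans_le (hmax r₁), ?_⟩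
  have hdN : Tendsto d atTop atTop := tendsto_natCast_atTop_iff.1 hdi
  set K := -r₀ ^ 2 / 2 + ρ * Real.log (stdPhi r₀) with hKdef
  have hMK : ((ρ + 1) * Real.log (ρ + 1) - ρ * Real.log ρ) + K = M := by
    rw [← hr₀, grho]; ring
  have hK : ∀ r : ℝ, -r ^ 2 / 2 + ρ * Real.log (stdPhi r) ≤ K := by
    intro r
    have h := hmax r
    rw [grho] at h
    linarith
  have hpos : ∀ᶠ n in atTop, 0 < II n (d n) (-1) 1 :=
    (eventually_le_log_II_div hd hdN hreg (sub_one_lt K)).mono fun n hn => hn.1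
  have hII : Tendsto (fun n => Real.log (II n (d n) (-1) 1) / (d n : ℝ)) atTop (𝓝 K) :=
    tendsto_order.2
      ⟨fun c hc => (eventually_le_log_II_div hd hdN hreg hc).mono fun n hn => hn.2,
        fun c hc => eventually_log_II_div_lt hd hdN hreg hpos hK hc⟩
  have key := (((tendsto_log_choose_div hρ hd hdN hreg).add
    ((tendsto_const_div_nat (Real.log 2)).comp hdN)).add (tendsto_log_c2_div.comp hdN)).add hII
  rw [add_zero, add_zero, hMK] at key
  refine key.congr' ?_
  filter_upwards [hd, hpos, hdN.eventually (eventually_ge_atTop 3)] with n h1 h2 h3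
  have hch : (0 : ℝ) < n.choose (d n) := by exact_mod_cast Nat.choose_pos h1.2.le
  have hc2 := c2_pos h3
  rw [FF, Real.log_mul (by positivity) h2.ne', Real.log_mul (by positivity) hc2.ne',
    Real.log_mul hch.ne' (by norm_num)]
  simp only [Function.comp, add_div]
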